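/- arXiv:math/0407488 — 3 statements merged into one kernel-verified Lean document; each statement's English description precedes it below -/
import Mathlib

section
/- (Schoenberg correspondence) Let B be an involutive bialgebra over ℂ and let (φ_t)_{t≥0} be a convolution semigroup of unital linear functionals on B, i.e. φ_0 = ε, φ_s ⋆ φ_t = φ_{s+t} for all s,t ≥ 0, φ_t(1) = 1, and lim_{t↘0} φ_t(b) = ε(b) for every b ∈ B, and suppose that for every b ∈ B the limit L(b) = lim_{t↘0} (φ_t(b) − ε(b))/t exists. Then the following are equivalent: (i) for every t ≥ 0 and every b ∈ B, φ_t(b* b) is a nonnegative real number (i.e. each φ_t is a state); (ii) L(1) = 0, L is hermitian (L(b*) = conj(L(b)) for all b ∈ B), and L is conditionally positive (L(b* b) is a nonnegative real number for every b ∈ B with ε(b) = 0). -/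
open scoped TensorProduct ComplexOrder

/-- The convolution of two linear functionals on a coalgebra over `ℂ`. -/
noncomputable def conv {B : Type*} [AddCommGroup B] [Module ℂ B] [Coalgebra ℂ B]
    (φ ψ : B →ₗ[ℂ] ℂ) : B →ₗ[ℂ] ℂ :=
  LinearMap.mul' ℂ ℂ ∘ₗ TensorProduct.map φ ψ ∘ₗ Coalgebra.comul

/-- The conjugate-linear map `* ⊗ * : B ⊗ B → B ⊗ B`, `a ⊗ b ↦ a* ⊗ b*`,
realized as an additive monoid homomorphism. -/
noncomputable def starTensor (B : Type*) [AddCommGroup B] [Module ℂ B]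
    [StarAddMonoid B] [StarModule ℂ B] :
    B ⊗[ℂ] B →+ B ⊗[ℂ] B :=
  TensorProduct.liftAddHom
    { toFun := fun a =>
        { toFun := fun b => star a ⊗ₜ[ℂ] star b
          map_zero' := by simp
          map_add' := fun b₁ b₂ => by simp [star_add, TensorProduct.tmul_add]
        }
      map_zero' := by ext b; simp
      map_add' := fun a₁ a₂ => by ext b; simp [star_add, TensorProduct.add_tmul]
    }
    (fun c a b => by
      simp only [AddMonoidHom.coe_mk, ZeroHom.coe_mk, star_smul]
      exact TensorProduct.smul_tmul _ _ _)

/-- Two families in a normed ring with the same derivative at `0⁺` have the same Lie–Trotter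
limit. -/
theorem tendsto_pow_sub_pow_of_tendsto_slope {A : Type*} [NormedRing A] [NormOneClass A]
    [NormedSpace ℝ A] {F G : ℝ → A} {X : A}
    (hF : Filter.Tendsto (fun s : ℝ => s⁻¹ • (F s - 1)) (nhdsWithin 0 (Set.Ioi 0)) (nhds X))
    (hG : Filter.Tendsto (fun s : ℝ => s⁻¹ • (G s - 1)) (nhdsWithin 0 (Set.Ioi 0)) (nhds X))
    {t : ℝ} (ht : 0 < t) :
    Filter.Tendsto (fun n : ℕ => F (t / (n + 1)) ^ (n + 1) - G (t / (n + 1)) ^ (n + 1))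
      Filter.atTop (nhds 0) := by
  have pow_bound : ∀ (a b : A) (ρ : ℝ), ‖a‖ ≤ ρ → ‖b‖ ≤ ρ → 1 ≤ ρ → ∀ n : ℕ,
      ‖a ^ n - b ^ n‖ ≤ n * ρ ^ n * ‖a - b‖ := by
    intro a b ρ ha hb hρ n
    induction n with
    | zero => simp
    | succ n ih =>
      have h0 : (0 : ℝ) ≤ ρ := zero_le_one.trans hρ
      have hpow : ‖b ^ n‖ ≤ ρ ^ n := (norm_pow_le b n).trans (pow_le_pow_left₀ (norm_nonneg b) hb n)
      have hsplit : a ^ (n + 1) - b ^ (n + 1) = (a ^ n - b ^ n) * a + b ^ n * (a - b) := by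
        rw [pow_succ, pow_succ]; noncomm_ring
      calc ‖a ^ (n + 1) - b ^ (n + 1)‖
          ≤ ‖a ^ n - b ^ n‖ * ‖a‖ + ‖b ^ n‖ * ‖a - b‖ := by
            rw [hsplit]
            exact (norm_add_le _ _).trans (add_le_add (norm_mul_le _ _) (norm_mul_le _ _))
        _ ≤ (n * ρ ^ n * ‖a - b‖) * ρ + (ρ ^ n * ρ) * ‖a - b‖ := by
            gcongr
            exact hpow.trans (le_mul_of_one_le_right (pow_nonneg h0 n) hρ)
        _ = (n + 1 : ℕ) * ρ ^ (n + 1) * ‖a - b‖ := by push_cast; ring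
  have norm_bound : ∀ {H : ℝ → A}, Filter.Tendsto (fun s : ℝ => s⁻¹ • (H s - 1))
      (nhdsWithin 0 (Set.Ioi 0)) (nhds X) →
      ∀ᶠ s in nhdsWithin (0 : ℝ) (Set.Ioi 0), ‖H s‖ ≤ Real.exp ((‖X‖ + 1) * s) := by
    intro H hH
    filter_upwards [hH.norm.eventually_lt_const (lt_add_one ‖X‖), self_mem_nhdsWithin] with s hs hs0
    have hs0 : 0 < s := hs0
    have hsub : ‖H s - 1‖ ≤ (‖X‖ + 1) * s := by
      rw [norm_smul, norm_inv, Real.norm_of_nonneg hs0.le] at hs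
      rw [inv_mul_lt_iff₀ hs0] at hs
      linarith
    calc ‖H s‖ = ‖(H s - 1) + 1‖ := by simp
      _ ≤ ‖H s - 1‖ + 1 := by simpa using norm_add_le (H s - 1) 1
      _ ≤ (‖X‖ + 1) * s + 1 := by linarith
      _ ≤ _ := Real.add_one_le_exp _
  have hstep : Filter.Tendsto (fun n : ℕ => t / ((n : ℝ) + 1)) Filter.atTop
      (nhdsWithin 0 (Set.Ioi 0)) := by
    refine tendsto_nhdsWithin_iff.2 ⟨?_, Filter.Eventually.of_forall fun n => ?_⟩
    · exact tendsto_const_nhds.div_atTop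
        (Filter.tendsto_atTop_add_const_right _ _ tendsto_natCast_atTop_atTop)
    · exact div_pos ht (by positivity)
  have hdiff : Filter.Tendsto (fun s : ℝ => ‖s⁻¹ • (F s - G s)‖)
      (nhdsWithin 0 (Set.Ioi 0)) (nhds 0) := by
    have h := (hF.sub hG).norm
    simpa [← smul_sub] using h
  refine squeeze_zero_norm' (a := fun n : ℕ => t * Real.exp ((‖X‖ + 1) * t) *
    ‖(t / ((n : ℝ) + 1))⁻¹ • (F (t / (n + 1)) - G (t / (n + 1)))‖) ?_ ?_
  · filter_upwards [hstep.eventually (norm_bound hF), hstep.eventually (norm_bound hG)]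
      with n hFn hGn
    have hn : (0 : ℝ) < n + 1 := by positivity
    have hs : 0 < t / ((n : ℝ) + 1) := div_pos ht hn
    refine (pow_bound _ _ _ hFn hGn (Real.one_le_exp (by positivity)) (n + 1)).trans (le_of_eq ?_)
    rw [← Real.exp_nat_mul, norm_smul, norm_inv, Real.norm_of_nonneg hs.le]
    have : ((n + 1 : ℕ) : ℝ) * ((‖X‖ + 1) * (t / (n + 1))) = (‖X‖ + 1) * t := by
      push_cast; field_simp
    rw [this]
    push_cast
    field_simp
  · simpa using (hdiff.comp hstep).const_mul (t * Real.exp ((‖X‖ + 1) * t))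

/-- The functional `g` applied to the third leg commutes with tensoring on the left. -/
theorem rid_lTensor_assoc_symm_tmul {R M : Type*} [CommRing R] [AddCommGroup M] [Module R M]
    (g : M →ₗ[R] R) (a : M) (z : M ⊗[R] M) :
    TensorProduct.rid R (M ⊗[R] M)
      (g.lTensor (M ⊗[R] M) ((TensorProduct.assoc R M M M).symm (a ⊗ₜ z))) =
      a ⊗ₜ TensorProduct.rid R M (g.lTensor M z) := by
  induction z with
  | zero => simp
  | add x y hx hy => simp only [TensorProduct.tmul_add, map_add, hx, hy]
  | tmul x y => simp

/-- Every element of a coalgebra over a field lies in the span of the entries of a matrix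
coalgebra `Δ c i j = ∑ k, c i k ⊗ c k j`, `ε (c i j) = δ i j`. -/
theorem exists_matrix_coalgebra {K B : Type*} [Field K] [AddCommGroup B] [Module K B]
    [Coalgebra K B] (b : B) :
    ∃ (n : ℕ) (c : Matrix (Fin n) (Fin n) B) (x : Fin n × Fin n → K),
      (∀ i j, Coalgebra.comul (R := K) (c i j) = ∑ k, c i k ⊗ₜ[K] c k j) ∧
      (∀ i j, Coalgebra.counit (R := K) (c i j) = if i = j then 1 else 0) ∧
      b = ∑ p, x p • c p.1 p.2 := by
  classical
  let f := Module.Basis.ofVectorSpace K B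
  obtain ⟨a, ha⟩ := TensorProduct.eq_repr_basis_right f (Coalgebra.comul (R := K) b)
  have comul_a : ∀ m, Coalgebra.comul (R := K) (a m) =
      ∑ p ∈ a.support, a p ⊗ₜ
        TensorProduct.rid K B ((f.coord m).lTensor B (Coalgebra.comul (R := K) (f p))) := by
    intro m
    have h := Coalgebra.coassoc_symm_apply (R := K) b
    rw [← ha] at h
    have h' := congrArg (fun z => TensorProduct.rid K (B ⊗[K] B)
      ((f.coord m).lTensor (B ⊗[K] B) z)) h
    simp only [Finsupp.sum, map_sum, LinearMap.lTensor_tmul, LinearMap.rTensor_tmul,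
      rid_lTensor_assoc_symm_tmul, TensorProduct.rid_tmul, Module.Basis.coord_apply,
      Module.Basis.repr_self, Finsupp.single_apply, ite_smul, one_smul, zero_smul,
      Finset.sum_ite_eq', Finsupp.mem_support_iff] at h'
    rw [h']
    split_ifs with hm
    · rfl
    · simp [not_not.1 hm]
  let V : Submodule K B := Submodule.span K (a '' a.support)
  have : FiniteDimensional K V :=
    FiniteDimensional.span_of_finite K (a.support.finite_toSet.image a)
  let v := Module.finBasis K V
  let e : Fin (Module.finrank K V) → B := fun i => v i
  have hV : ∀ y ∈ V, ∃ β : Fin (Module.finrank K V) → K, y = ∑ i, β i • e i := by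
    intro y hy
    refine ⟨fun i => v.repr ⟨y, hy⟩ i, ?_⟩
    have h := congrArg V.subtype (v.sum_repr ⟨y, hy⟩)
    rw [map_sum] at h
    exact h.symm
  have hdual : ∀ i, ∃ g : B →ₗ[K] K, ∀ j, g (e j) = if j = i then 1 else 0 := by
    intro i
    obtain ⟨g, hg⟩ := LinearMap.exists_extend (v.coord i)
    refine ⟨g, fun j => ?_⟩
    have := LinearMap.congr_fun hg (v j)
    simpa [e, Finsupp.single_apply] using this
  choose g hg using hdual
  have comul_V : ∀ y ∈ V, ∃ w : Fin (Module.finrank K V) → B,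
      Coalgebra.comul (R := K) y = ∑ j, e j ⊗ₜ w j := by
    intro y hy
    induction hy using Submodule.span_induction with
    | mem y hy =>
      obtain ⟨m, -, rfl⟩ := hy
      have haV : ∀ p, ∃ β : Fin (Module.finrank K V) → K, p ∈ a.support →
          a p = ∑ i, β i • e i := by
        intro p
        by_cases hp : p ∈ a.support
        · obtain ⟨β, hβ⟩ := hV _ (Submodule.subset_span ⟨p, hp, rfl⟩)
          exact ⟨β, fun _ => hβ⟩
        · exact ⟨0, fun h => absurd h hp⟩
      choose β hβ using haV
      refine ⟨fun j => ∑ p ∈ a.support, β p j •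
        TensorProduct.rid K B ((f.coord m).lTensor B (Coalgebra.comul (R := K) (f p))), ?_⟩
      rw [comul_a]
      simp_rw [TensorProduct.tmul_sum]
      rw [Finset.sum_comm]
      refine Finset.sum_congr rfl fun p hp => ?_
      conv_lhs => rw [hβ p hp]
      simp_rw [TensorProduct.sum_tmul, TensorProduct.smul_tmul]
    | zero => exact ⟨0, by simp⟩
    | add y z _ _ hy hz =>
      obtain ⟨w, hw⟩ := hy
      obtain ⟨w', hw'⟩ := hz
      exact ⟨w + w', by simp [hw, hw', TensorProduct.tmul_add, Finset.sum_add_distrib]⟩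
    | smul r y _ hy =>
      obtain ⟨w, hw⟩ := hy
      exact ⟨r • w, by simp [hw, Finset.smul_sum]⟩
  have comul_e : ∀ i, ∃ w : Fin (Module.finrank K V) → B,
      Coalgebra.comul (R := K) (e i) = ∑ j, e j ⊗ₜ w j := fun i => comul_V _ (v i).2
  choose c hc using comul_e
  have b_mem : b ∈ V := by
    have h := Coalgebra.lTensor_counit_comul (R := K) b
    rw [← ha] at h
    have h' := congrArg (TensorProduct.rid K B) h
    simp only [Finsupp.sum, map_sum, LinearMap.lTensor_tmul, TensorProduct.rid_tmul,
      one_smul] at h'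
    rw [← h']
    exact V.sum_mem fun p hp => V.smul_mem _ (Submodule.subset_span ⟨p, hp, rfl⟩)
  obtain ⟨β, hβ⟩ := hV b b_mem
  refine ⟨_, fun j i => c i j,
    fun p => β p.2 * Coalgebra.counit (R := K) (e p.1), fun k i => ?_, fun k i => ?_, ?_⟩
  · have h := Coalgebra.coassoc_apply (R := K) (e i)
    have h' := congrArg (fun z => TensorProduct.lid K (B ⊗[K] B) ((g k).rTensor (B ⊗[K] B) z)) h
    simpa [hc, TensorProduct.sum_tmul, hg] using h'.symm
  · have h := Coalgebra.lTensor_counit_comul (R := K) (e i)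
    have h' := congrArg (fun z => g k (TensorProduct.rid K B z)) h
    simp only [hc, map_sum, LinearMap.lTensor_tmul, TensorProduct.rid_tmul, map_smul, hg,
      one_smul, smul_eq_mul, mul_ite, mul_one, mul_zero, Finset.sum_ite_eq',
      Finset.mem_univ, if_true] at h'
    simpa only [eq_comm] using h'
  · conv_lhs => rw [hβ]
    rw [Fintype.sum_prod_type, Finset.sum_comm]
    refine Finset.sum_congr rfl fun i _ => ?_
    have h := congrArg (TensorProduct.lid K B) (Coalgebra.rTensor_counit_comul (R := K) (e i))
    simp only [hc, map_sum, LinearMap.rTensor_tmul, TensorProduct.lid_tmul, one_smul] at h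
    conv_lhs => rw [← h]
    simp [Finset.smul_sum, mul_smul]

section StarMulMatrix

open scoped Kronecker

variable {ι : Type*}

/-- The reshuffling of a matrix on `ι × ι` which turns `conj V ⊗ V` into a rank one matrix. -/
def choiMatrix (M : Matrix (ι × ι) (ι × ι) ℂ) : Matrix (ι × ι) (ι × ι) ℂ :=
  Matrix.of fun p q => M (p.1, q.1) (p.2, q.2)

theorem choiMatrix_posSemidef_iff [Finite ι] {M : Matrix (ι × ι) (ι × ι) ℂ} :
    (choiMatrix M).PosSemidef ↔
      ∃ (m : ℕ) (V : Fin m → Matrix ι ι ℂ), M = ∑ i, (V i).map star ⊗ₖ V i := by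
  rw [Matrix.posSemidef_iff_eq_sum_vecMulVec]
  constructor
  · rintro ⟨m, v, hv⟩
    refine ⟨m, fun i => Matrix.of fun j k => star (v i (j, k)), ?_⟩
    ext ⟨i, k⟩ ⟨j, l⟩
    have h := congrFun (congrFun hv (i, j)) (k, l)
    simpa [choiMatrix, Matrix.sum_apply, Matrix.vecMulVec_apply] using h
  · rintro ⟨m, V, rfl⟩
    refine ⟨m, fun i p => star (V i p.1 p.2), ?_⟩
    ext ⟨i, j⟩ ⟨k, l⟩
    simp [choiMatrix, Matrix.sum_apply, Matrix.vecMulVec_apply]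

theorem choiMatrix_posSemidef_kronecker [Finite ι] (V : Matrix ι ι ℂ) :
    (choiMatrix (V.map star ⊗ₖ V)).PosSemidef :=
  choiMatrix_posSemidef_iff.2 ⟨1, fun _ => V, by simp⟩

theorem choiMatrix_posSemidef_mul [Fintype ι] {M N : Matrix (ι × ι) (ι × ι) ℂ}
    (hM : (choiMatrix M).PosSemidef) (hN : (choiMatrix N).PosSemidef) :
    (choiMatrix (M * N)).PosSemidef := by
  obtain ⟨m, V, rfl⟩ := choiMatrix_posSemidef_iff.1 hM
  obtain ⟨n, W, rfl⟩ := choiMatrix_posSemidef_iff.1 hN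
  have h : choiMatrix ((∑ i, (V i).map star ⊗ₖ V i) * ∑ j, (W j).map star ⊗ₖ W j) =
      ∑ i, ∑ j, choiMatrix ((V i * W j).map star ⊗ₖ (V i * W j)) := by
    have hmap : ∀ i j, (V i * W j).map star = (V i).map star * (W j).map star := fun i j =>
      Matrix.map_mul (f := starRingEnd ℂ)
    rw [Finset.sum_mul_sum]
    simp_rw [hmap, Matrix.mul_kronecker_mul]
    ext p q
    simp [choiMatrix, Matrix.sum_apply]
  rw [h]
  exact Matrix.posSemidef_sum _ fun i _ => Matrix.posSemidef_sum _ fun j _ =>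
    choiMatrix_posSemidef_kronecker _

theorem choiMatrix_posSemidef_pow [Fintype ι] [DecidableEq ι] {M : Matrix (ι × ι) (ι × ι) ℂ}
    (hM : (choiMatrix M).PosSemidef) (n : ℕ) : (choiMatrix (M ^ n)).PosSemidef := by
  induction n with
  | zero =>
    have h := choiMatrix_posSemidef_kronecker (1 : Matrix ι ι ℂ)
    rwa [Matrix.map_one _ (star_zero ℂ) (star_one ℂ), Matrix.one_kronecker_one] at h
  | succ n ih => exact pow_succ M n ▸ choiMatrix_posSemidef_mul ih hM

variable {B : Type*} [Ring B]

/-- The values of the sesquilinear form `(a, b) ↦ φ (a* b)` on the entries of a matrix `c`. -/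
def starMulMatrix [Module ℂ B] [Star B] (c : Matrix ι ι B) (φ : B →ₗ[ℂ] ℂ) :
    Matrix (ι × ι) (ι × ι) ℂ :=
  Matrix.of fun p q => φ (star (c p.1 q.1) * c p.2 q.2)

theorem dotProduct_choiMatrix_starMulMatrix [Fintype ι] [Algebra ℂ B] [StarRing B]
    [StarModule ℂ B] (c : Matrix ι ι B) (φ : B →ₗ[ℂ] ℂ) (x : ι × ι → ℂ) :
    star x ⬝ᵥ (choiMatrix (starMulMatrix c φ)).mulVec x =
      φ (star (∑ p, x p • c p.1 p.2) * ∑ p, x p • c p.1 p.2) := by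
  rw [star_sum, Finset.sum_mul_sum]
  simp only [dotProduct, Matrix.mulVec, choiMatrix, starMulMatrix, Matrix.of_apply,
    star_smul, smul_mul_smul_comm, map_sum, map_smul, smul_eq_mul, Pi.star_apply, Finset.mul_sum]
  refine Finset.sum_congr rfl fun p _ => Finset.sum_congr rfl fun q _ => ?_
  ring

theorem starMulMatrix_conv [Fintype ι] [Bialgebra ℂ B] [StarRing B] [StarModule ℂ B]
    (hcomul_star : ∀ b : B,
      Coalgebra.comul (R := ℂ) (star b) = starTensor B (Coalgebra.comul (R := ℂ) b))
    {c : Matrix ι ι B}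
    (hc : ∀ i j, Coalgebra.comul (R := ℂ) (c i j) = ∑ k, c i k ⊗ₜ[ℂ] c k j)
    (φ ψ : B →ₗ[ℂ] ℂ) :
    starMulMatrix c (conv φ ψ) = starMulMatrix c φ * starMulMatrix c ψ := by
  have hstar : ∀ a b : B, starTensor B (a ⊗ₜ[ℂ] b) = star a ⊗ₜ star b := fun _ _ => rfl
  ext ⟨i, k⟩ ⟨j, l⟩
  simp [starMulMatrix, conv, Matrix.mul_apply, Bialgebra.comul_mul, hcomul_star, hc, hstar,
    Finset.sum_mul_sum, Fintype.sum_prod_type]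

theorem starMulMatrix_counit [Bialgebra ℂ B] [StarRing B] [DecidableEq ι]
    (hcounit_star : ∀ b : B,
      Coalgebra.counit (R := ℂ) (star b) = starRingEnd ℂ (Coalgebra.counit (R := ℂ) b))
    {c : Matrix ι ι B}
    (hc : ∀ i j, Coalgebra.counit (R := ℂ) (c i j) = if i = j then 1 else 0) :
    starMulMatrix c (Coalgebra.counit (R := ℂ)) = 1 := by
  ext ⟨i, k⟩ ⟨j, l⟩
  by_cases hij : i = j <;> by_cases hkl : k = l <;>
    simp [starMulMatrix, hcounit_star, hc, hij, hkl, Matrix.one_apply]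

/-- For a conditionally positive hermitian `L`, the first order approximation of the semigroup
generated by `L` can be corrected to second order to become completely positive. -/
theorem exists_choiMatrix_posSemidef_approximation [Fintype ι] [DecidableEq ι] [Bialgebra ℂ B]
    [StarRing B] [StarModule ℂ B] {L : B →ₗ[ℂ] ℂ} (hL1 : L 1 = 0)
    (hLstar : ∀ b : B, L (star b) = starRingEnd ℂ (L b))
    (hLpos : ∀ b : B, Coalgebra.counit (R := ℂ) b = 0 → 0 ≤ L (star b * b))
    {c : Matrix ι ι B}
    (hc : ∀ i j, Coalgebra.counit (R := ℂ) (c i j) = if i = j then 1 else 0) :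
    ∃ E : Matrix (ι × ι) (ι × ι) ℂ, ∀ s : ℝ, 0 ≤ s →
      (choiMatrix (1 + s • starMulMatrix c L + s ^ 2 • E)).PosSemidef := by
  let Λ : Matrix ι ι ℂ := c.map L
  let d : Matrix ι ι B := c - 1
  have hd : (choiMatrix (starMulMatrix d L)).PosSemidef := by
    refine Matrix.PosSemidef.of_dotProduct_mulVec_nonneg ?_ fun x => ?_
    · ext p q
      simp [choiMatrix, starMulMatrix, ← hLstar]
    · rw [dotProduct_choiMatrix_starMulMatrix]
      refine hLpos _ ?_
      rw [map_sum]
      refine Finset.sum_eq_zero fun p _ => ?_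
      by_cases h : p.1 = p.2 <;> simp [d, hc, h]
  refine ⟨Λ.map star ⊗ₖ Λ, fun s hs => ?_⟩
  have key : 1 + s • starMulMatrix c L + s ^ 2 • (Λ.map star ⊗ₖ Λ) =
      (1 + s • Λ).map star ⊗ₖ (1 + s • Λ) + s • starMulMatrix d L := by
    ext ⟨i, k⟩ ⟨j, l⟩
    by_cases hij : i = j <;> by_cases hkl : k = l <;>
      simp [starMulMatrix, d, Λ, hij, hkl, Matrix.one_apply, hL1, sub_mul, mul_sub, hLstar] <;>
      ring
  have hadd : choiMatrix (1 + s • starMulMatrix c L + s ^ 2 • (Λ.map star ⊗ₖ Λ)) =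
      choiMatrix ((1 + s • Λ).map star ⊗ₖ (1 + s • Λ)) + s • choiMatrix (starMulMatrix d L) := by
    rw [key]
    rfl
  rw [hadd]
  exact (choiMatrix_posSemidef_kronecker _).add (hd.smul hs)

end StarMulMatrix

attribute [local instance] Matrix.linftyOpNormedRing Matrix.linftyOpNormedSpace in
/-- A convolution semigroup with hermitian, conditionally positive generator is positive. -/
theorem nonneg_of_conditionally_positive_generator
    {B : Type*} [Ring B] [Bialgebra ℂ B] [StarRing B] [StarModule ℂ B]
    (hcomul_star : ∀ b : B,
      Coalgebra.comul (R := ℂ) (star b) = starTensor B (Coalgebra.comul (R := ℂ) b))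
    (hcounit_star : ∀ b : B,
      Coalgebra.counit (R := ℂ) (star b) = starRingEnd ℂ (Coalgebra.counit (R := ℂ) b))
    {φ : ℝ → (B →ₗ[ℂ] ℂ)}
    (hφ0 : φ 0 = Coalgebra.counit)
    (hφsg : ∀ s t : ℝ, 0 ≤ s → 0 ≤ t → conv (φ s) (φ t) = φ (s + t))
    {L : B →ₗ[ℂ] ℂ}
    (hL : ∀ b : B, Filter.Tendsto
      (fun t : ℝ => (φ t b - Coalgebra.counit (R := ℂ) b) / (t : ℂ))
      (nhdsWithin 0 (Set.Ioi 0)) (nhds (L b)))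
    (hL1 : L 1 = 0) (hLstar : ∀ b : B, L (star b) = starRingEnd ℂ (L b))
    (hLpos : ∀ b : B, Coalgebra.counit (R := ℂ) b = 0 → 0 ≤ L (star b * b))
    {t : ℝ} (ht : 0 < t) (b : B) : 0 ≤ φ t (star b * b) := by
  obtain ⟨n, c, x, hc, hc1, rfl⟩ := exists_matrix_coalgebra (K := ℂ) b
  rcases isEmpty_or_nonempty (Fin n) with _ | _
  · simp
  obtain ⟨E, hE⟩ := exists_choiMatrix_posSemidef_approximation hL1 hLstar hLpos hc1
  have hcounit := starMulMatrix_counit hcounit_star hc1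
  let F : ℝ → Matrix (Fin n × Fin n) (Fin n × Fin n) ℂ := fun s => starMulMatrix c (φ s)
  let G : ℝ → Matrix (Fin n × Fin n) (Fin n × Fin n) ℂ := fun s =>
    1 + s • starMulMatrix c L + s ^ 2 • E
  have hFpow : ∀ s : ℝ, 0 ≤ s → ∀ m : ℕ, F s ^ m = F (m * s) := by
    intro s hs m
    induction m with
    | zero => simp [F, hφ0, hcounit]
    | succ m ih =>
      rw [pow_succ, ih, ← starMulMatrix_conv hcomul_star hc, hφsg _ _ (by positivity) hs]
      congr 2
      push_cast
      ring
  have hF : Filter.Tendsto (fun s : ℝ => s⁻¹ • (F s - 1)) (nhdsWithin 0 (Set.Ioi 0))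
      (nhds (starMulMatrix c L)) := by
    refine tendsto_pi_nhds.2 fun p => tendsto_pi_nhds.2 fun q => ?_
    refine (hL (star (c p.1 q.1) * c p.2 q.2)).congr fun s => ?_
    rw [← hcounit]
    simp [F, starMulMatrix, div_eq_inv_mul]
  have hG : Filter.Tendsto (fun s : ℝ => s⁻¹ • (G s - 1)) (nhdsWithin 0 (Set.Ioi 0))
      (nhds (starMulMatrix c L)) := by
    have hcont : Filter.Tendsto (fun s : ℝ => starMulMatrix c L + s • E)
        (nhdsWithin 0 (Set.Ioi 0)) (nhds (starMulMatrix c L + (0 : ℝ) • E)) :=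
      tendsto_const_nhds.add ((Filter.tendsto_id.mono_left nhdsWithin_le_nhds).smul_const E)
    rw [zero_smul, add_zero] at hcont
    refine hcont.congr' ?_
    filter_upwards [self_mem_nhdsWithin] with s hs
    have hs : s ≠ 0 := ne_of_gt hs
    have hsub : G s - 1 = s • (starMulMatrix c L + s • E) := by
      simp only [G, smul_add, smul_smul, sq]
      abel
    rw [hsub, inv_smul_smul₀ hs]
  have hlim : Filter.Tendsto (fun m : ℕ => G (t / (m + 1)) ^ (m + 1)) Filter.atTop
      (nhds (F t)) := by
    have h := (tendsto_const_nhds (x := F t)).sub (tendsto_pow_sub_pow_of_tendsto_slope hF hG ht)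
    rw [sub_zero] at h
    refine h.congr fun m => ?_
    have hm : ((m + 1 : ℕ) : ℝ) * (t / (m + 1)) = t := by
      push_cast
      field_simp
    rw [hFpow _ (by positivity), hm, sub_sub_cancel]
  have hcont : Continuous fun M : Matrix (Fin n × Fin n) (Fin n × Fin n) ℂ =>
      star x ⬝ᵥ (choiMatrix M).mulVec x := by
    unfold dotProduct Matrix.mulVec dotProduct choiMatrix
    simp only [Matrix.of_apply]
    fun_prop
  rw [← dotProduct_choiMatrix_starMulMatrix]
  exact ge_of_tendsto' ((hcont.tendsto _).comp hlim) fun m =>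
    (choiMatrix_posSemidef_pow (hE _ (by positivity)) _).dotProduct_mulVec_nonneg x

/-- A functional that is positive on a complex unital `*`-algebra is hermitian. -/
theorem map_star_of_nonneg {B : Type*} [Ring B] [Algebra ℂ B] [StarRing B] [StarModule ℂ B]
    {φ : B →ₗ[ℂ] ℂ} (hφ : ∀ b : B, 0 ≤ φ (star b * b)) (b : B) :
    φ (star b) = starRingEnd ℂ (φ b) := by
  have h1 := (Complex.nonneg_iff.1 (hφ 1)).2
  have hb := (Complex.nonneg_iff.1 (hφ b)).2
  have hadd := (Complex.nonneg_iff.1 (hφ (1 + b))).2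
  have hI := (Complex.nonneg_iff.1 (hφ (1 + Complex.I • b))).2
  simp [add_mul, mul_add, smul_smul] at h1 hb hadd hI
  apply Complex.ext
  · simp; linarith
  · simp; linarith

/-- (Schoenberg correspondence)  For a convolution semigroup `(φ_t)` of unital linear
functionals on an involutive bialgebra `B` with generator `L`, the functionals `φ_t`
are all states if and only if `L(1) = 0`, `L` is hermitian and `L` is conditionally
positive. -/
theorem schoenberg_correspondence
    {B : Type*} [Ring B] [Bialgebra ℂ B] [StarRing B] [StarModule ℂ B]
    (hcomul_star : ∀ b : B,
      Coalgebra.comul (R := ℂ) (star b) = starTensor B (Coalgebra.comul (R := ℂ) b))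
    (hcounit_star : ∀ b : B,
      Coalgebra.counit (R := ℂ) (star b) = starRingEnd ℂ (Coalgebra.counit (R := ℂ) b))
    (φ : ℝ → (B →ₗ[ℂ] ℂ))
    (hφ0 : φ 0 = Coalgebra.counit)
    (hφsg : ∀ s t : ℝ, 0 ≤ s → 0 ≤ t → conv (φ s) (φ t) = φ (s + t))
    (hφ1 : ∀ t : ℝ, 0 ≤ t → φ t 1 = 1)
    (hφcont : ∀ b : B, Filter.Tendsto (fun t : ℝ => φ t b)
      (nhdsWithin 0 (Set.Ioi 0)) (nhds (Coalgebra.counit (R := ℂ) b)))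
    (L : B →ₗ[ℂ] ℂ)
    (hL : ∀ b : B, Filter.Tendsto
      (fun t : ℝ => (φ t b - Coalgebra.counit (R := ℂ) b) / (t : ℂ))
      (nhdsWithin 0 (Set.Ioi 0)) (nhds (L b))) :
    (∀ t : ℝ, 0 ≤ t → ∀ b : B, 0 ≤ φ t (star b * b)) ↔
      (L 1 = 0 ∧ (∀ b : B, L (star b) = starRingEnd ℂ (L b)) ∧
        ∀ b : B, Coalgebra.counit (R := ℂ) b = 0 → 0 ≤ L (star b * b)) := by
  have counit_nonneg : ∀ b : B, 0 ≤ Coalgebra.counit (R := ℂ) (star b * b) := fun b => by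
    rw [Bialgebra.counit_mul, hcounit_star]
    exact star_mul_self_nonneg (Coalgebra.counit (R := ℂ) b)
  constructor
  · intro hpos
    refine ⟨?_, fun b => ?_, fun b hb => ?_⟩
    · refine tendsto_nhds_unique (hL 1) (tendsto_const_nhds.congr' ?_)
      filter_upwards [self_mem_nhdsWithin] with t ht
      simp [hφ1 t (le_of_lt ht)]
    · refine tendsto_nhds_unique (hL (star b)) ?_
      refine ((Complex.continuous_conj.tendsto _).comp (hL b)).congr' ?_
      filter_upwards [self_mem_nhdsWithin] with t ht
      simp [map_star_of_nonneg (hpos t (le_of_lt ht)), hcounit_star]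
    · refine ge_of_tendsto (hL (star b * b)) ?_
      filter_upwards [self_mem_nhdsWithin] with t ht
      have ht : 0 < t := ht
      rw [Bialgebra.counit_mul, hb, mul_zero, sub_zero]
      exact div_nonneg (hpos t ht.le b) (Complex.zero_le_real.2 ht.le)
  · rintro ⟨hL1, hLstar, hLpos⟩ t ht b
    rcases ht.eq_or_lt with rfl | ht
    · rw [hφ0]
      exact counit_nonneg b
    · exact nonneg_of_conditionally_positive_generator hcomul_star hcounit_star hφ0 hφsg hL
        hL1 hLstar hLpos ht b
end

section
/- Let A be a bialgebra over ℂ and let V and W be complex vector spaces, each equipped with a left action α_V: A ⊗ V → V resp. α_W: A ⊗ W → W and a left coaction γ_V: V → A ⊗ V resp. γ_W: W → A ⊗ W of A, such that on each of V and W the compatibility condition (m ⊗ α) ∘ (id ⊗ τ ⊗ id) ∘ (Δ ⊗ γ) = (m ⊗ id) ∘ (id ⊗ τ) ∘ (γ ⊗ id) ∘ (α ⊗ id) ∘ (id ⊗ τ) ∘ (Δ ⊗ id) holds as linear maps A ⊗ V → A ⊗ V resp. A ⊗ W → A ⊗ W. Then the map Ψ = (α_W ⊗ id_V) ∘ (id_A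 ⊗ τ_{V,W}) ∘ (γ_V ⊗ id_W): V ⊗ W → W ⊗ V is a module map and a comodule map: Ψ ∘ α_{V⊗W} = α_{W⊗V} ∘ (id_A ⊗ Ψ) and γ_{W⊗V} ∘ Ψ = (id_A ⊗ Ψ) ∘ γ_{V⊗W}, where the tensor product action is α_{V⊗W} = (α_V ⊗ α_W) ∘ (id ⊗ τ_{A,V} ⊗ id) ∘ (Δ ⊗ id ⊗ id) and the tensor product coaction is γ_{V⊗W} = (m ⊗ id ⊗ id) ∘ (id ⊗ τ_{V,A} ⊗ id) ∘ (γ_V ⊗ γ_W). -/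
open scoped TensorProduct

section Defs

variable {A V W : Type*} [Ring A] [Bialgebra ℂ A]
  [AddCommGroup V] [Module ℂ V] [AddCommGroup W] [Module ℂ W]

/-- The braiding `Ψ = (α_W ⊗ id) ∘ (id ⊗ τ) ∘ (γ_V ⊗ id) : V ⊗ W → W ⊗ V`. -/
noncomputable def braidPsi (αW : A ⊗[ℂ] W →ₗ[ℂ] W) (γV : V →ₗ[ℂ] A ⊗[ℂ] V) :
    V ⊗[ℂ] W →ₗ[ℂ] W ⊗[ℂ] V :=
  TensorProduct.map αW LinearMap.id
    ∘ₗ (TensorProduct.assoc ℂ A W V).symm.toLinearMap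
    ∘ₗ TensorProduct.map LinearMap.id (TensorProduct.comm ℂ V W).toLinearMap
    ∘ₗ (TensorProduct.assoc ℂ A V W).toLinearMap
    ∘ₗ TensorProduct.map γV LinearMap.id

/-- The tensor product action
`α_{V⊗W} = (α_V ⊗ α_W) ∘ (id ⊗ τ ⊗ id) ∘ (Δ ⊗ id ⊗ id) : A ⊗ (V ⊗ W) → V ⊗ W`. -/
noncomputable def actTensor (αV : A ⊗[ℂ] V →ₗ[ℂ] V) (αW : A ⊗[ℂ] W →ₗ[ℂ] W) :
    A ⊗[ℂ] (V ⊗[ℂ] W) →ₗ[ℂ] V ⊗[ℂ] W :=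
  TensorProduct.map αV αW
    ∘ₗ (TensorProduct.tensorTensorTensorComm ℂ A A V W).toLinearMap
    ∘ₗ TensorProduct.map (Coalgebra.comul (R := ℂ)) LinearMap.id

/-- The tensor product coaction
`γ_{V⊗W} = (m ⊗ id ⊗ id) ∘ (id ⊗ τ ⊗ id) ∘ (γ_V ⊗ γ_W) : V ⊗ W → A ⊗ (V ⊗ W)`. -/
noncomputable def coactTensor (γV : V →ₗ[ℂ] A ⊗[ℂ] V) (γW : W →ₗ[ℂ] A ⊗[ℂ] W) :
    V ⊗[ℂ] W →ₗ[ℂ] A ⊗[ℂ] (V ⊗[ℂ] W) :=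
  TensorProduct.map (LinearMap.mul' ℂ A) LinearMap.id
    ∘ₗ (TensorProduct.tensorTensorTensorComm ℂ A V A W).toLinearMap
    ∘ₗ TensorProduct.map γV γW

/-- The left-hand side `(m ⊗ α) ∘ (id ⊗ τ ⊗ id) ∘ (Δ ⊗ γ)` of the compatibility
condition between an action `α` and a coaction `γ`. -/
noncomputable def compatLHS (α : A ⊗[ℂ] V →ₗ[ℂ] V) (γ : V →ₗ[ℂ] A ⊗[ℂ] V) :
    A ⊗[ℂ] V →ₗ[ℂ] A ⊗[ℂ] V :=
  TensorProduct.map (LinearMap.mul' ℂ A) α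
    ∘ₗ (TensorProduct.tensorTensorTensorComm ℂ A A A V).toLinearMap
    ∘ₗ TensorProduct.map (Coalgebra.comul (R := ℂ)) γ

/-- The right-hand side
`(m ⊗ id) ∘ (id ⊗ τ) ∘ (γ ⊗ id) ∘ (α ⊗ id) ∘ (id ⊗ τ) ∘ (Δ ⊗ id)` of the
compatibility condition between an action `α` and a coaction `γ`. -/
noncomputable def compatRHS (α : A ⊗[ℂ] V →ₗ[ℂ] V) (γ : V →ₗ[ℂ] A ⊗[ℂ] V) :
    A ⊗[ℂ] V →ₗ[ℂ] A ⊗[ℂ] V :=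
  TensorProduct.map (LinearMap.mul' ℂ A) LinearMap.id
    ∘ₗ (TensorProduct.assoc ℂ A A V).symm.toLinearMap
    ∘ₗ TensorProduct.map LinearMap.id (TensorProduct.comm ℂ V A).toLinearMap
    ∘ₗ (TensorProduct.assoc ℂ A V A).toLinearMap
    ∘ₗ TensorProduct.map γ LinearMap.id
    ∘ₗ TensorProduct.map α LinearMap.id
    ∘ₗ (TensorProduct.assoc ℂ A V A).symm.toLinearMap
    ∘ₗ TensorProduct.map LinearMap.id (TensorProduct.comm ℂ A V).toLinearMap
    ∘ₗ (TensorProduct.assoc ℂ A A V).toLinearMap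
    ∘ₗ TensorProduct.map (Coalgebra.comul (R := ℂ)) LinearMap.id

end Defs

section Braiding

variable {A V W : Type*} [Ring A] [Bialgebra ℂ A]
  [AddCommGroup V] [Module ℂ V] [AddCommGroup W] [Module ℂ W]

/-- For fixed `v`, the map `a ⊗ b ↦ a v₍₋₁₎ ⊗ b v₍₀₎`. -/
noncomputable def compatLeft (α : A ⊗[ℂ] V →ₗ[ℂ] V) (γ : V →ₗ[ℂ] A ⊗[ℂ] V) (v : V) :
    A ⊗[ℂ] A →ₗ[ℂ] A ⊗[ℂ] V :=
  TensorProduct.map (LinearMap.mul' ℂ A) α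
    ∘ₗ (TensorProduct.tensorTensorTensorComm ℂ A A A V).toLinearMap
    ∘ₗ (TensorProduct.mk ℂ (A ⊗[ℂ] A) (A ⊗[ℂ] V)).flip (γ v)

/-- The map `(a ⊗ v) ⊗ b ↦ a b ⊗ v`. -/
noncomputable def mulRight : (A ⊗[ℂ] V) ⊗[ℂ] A →ₗ[ℂ] A ⊗[ℂ] V :=
  TensorProduct.map (LinearMap.mul' ℂ A) LinearMap.id
    ∘ₗ (TensorProduct.assoc ℂ A A V).symm.toLinearMap
    ∘ₗ TensorProduct.map LinearMap.id (TensorProduct.comm ℂ V A).toLinearMap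
    ∘ₗ (TensorProduct.assoc ℂ A V A).toLinearMap

@[simp]
theorem mulRight_tmul (a b : A) (v : V) : mulRight ((a ⊗ₜ[ℂ] v) ⊗ₜ[ℂ] b) = (a * b) ⊗ₜ[ℂ] v := by
  simp [mulRight]

/-- For fixed `v`, the map `a ⊗ b ↦ (a v)₍₋₁₎ b ⊗ (a v)₍₀₎`. -/
noncomputable def compatRight (α : A ⊗[ℂ] V →ₗ[ℂ] V) (γ : V →ₗ[ℂ] A ⊗[ℂ] V) (v : V) :
    A ⊗[ℂ] A →ₗ[ℂ] A ⊗[ℂ] V :=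
  mulRight ∘ₗ TensorProduct.map (γ ∘ₗ α ∘ₗ (TensorProduct.mk ℂ A V).flip v) LinearMap.id

@[simp]
theorem compatRight_tmul (α : A ⊗[ℂ] V →ₗ[ℂ] V) (γ : V →ₗ[ℂ] A ⊗[ℂ] V) (v : V) (a b : A) :
    compatRight α γ v (a ⊗ₜ[ℂ] b) = mulRight (γ (α (a ⊗ₜ[ℂ] v)) ⊗ₜ[ℂ] b) := by
  simp [compatRight]

theorem compatLHS_tmul (α : A ⊗[ℂ] V →ₗ[ℂ] V) (γ : V →ₗ[ℂ] A ⊗[ℂ] V) (a : A) (v : V) :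
    compatLHS α γ (a ⊗ₜ[ℂ] v) = compatLeft α γ v (Coalgebra.comul (R := ℂ) a) := by
  simp [compatLHS, compatLeft]

theorem compatRHS_tmul (α : A ⊗[ℂ] V →ₗ[ℂ] V) (γ : V →ₗ[ℂ] A ⊗[ℂ] V) (a : A) (v : V) :
    compatRHS α γ (a ⊗ₜ[ℂ] v) = compatRight α γ v (Coalgebra.comul (R := ℂ) a) := by
  simp only [compatRHS, LinearMap.comp_apply, TensorProduct.map_tmul, LinearMap.id_apply]
  induction Coalgebra.comul (R := ℂ) a using TensorProduct.induction_on with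
  | zero => simp
  | add x y hx hy => simp only [TensorProduct.add_tmul, map_add, hx, hy]
  | tmul b c => simp [mulRight]

theorem compatLeft_comp_comul {α : A ⊗[ℂ] V →ₗ[ℂ] V} {γ : V →ₗ[ℂ] A ⊗[ℂ] V}
    (h : compatLHS α γ = compatRHS α γ) (v : V) :
    compatLeft α γ v ∘ₗ Coalgebra.comul (R := ℂ) =
      compatRight α γ v ∘ₗ Coalgebra.comul (R := ℂ) := by
  ext a
  simpa only [compatLHS_tmul, compatRHS_tmul, LinearMap.comp_apply] using LinearMap.congr_fun h (a ⊗ₜ[ℂ] v)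

/-- For fixed `w`, the map `a ⊗ v ↦ a w ⊗ v`. -/
noncomputable def actOn (α : A ⊗[ℂ] W →ₗ[ℂ] W) (w : W) : A ⊗[ℂ] V →ₗ[ℂ] W ⊗[ℂ] V :=
  TensorProduct.map (α ∘ₗ (TensorProduct.mk ℂ A W).flip w) LinearMap.id

@[simp]
theorem actOn_tmul (α : A ⊗[ℂ] W →ₗ[ℂ] W) (w : W) (a : A) (v : V) :
    actOn α w (a ⊗ₜ[ℂ] v) = α (a ⊗ₜ[ℂ] w) ⊗ₜ[ℂ] v := by
  simp [actOn]

@[simp]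
theorem braidPsi_tmul (α : A ⊗[ℂ] W →ₗ[ℂ] W) (γ : V →ₗ[ℂ] A ⊗[ℂ] V) (v : V) (w : W) :
    braidPsi α γ (v ⊗ₜ[ℂ] w) = actOn α w (γ v) := by
  simp only [braidPsi, LinearMap.comp_apply, TensorProduct.map_tmul, LinearMap.id_apply]
  induction γ v using TensorProduct.induction_on with
  | zero => simp
  | add x y hx hy => simp only [TensorProduct.add_tmul, map_add, hx, hy]
  | tmul b c => simp

theorem actOn_mulRight {α : A ⊗[ℂ] W →ₗ[ℂ] W}
    (hmul : ∀ (a b : A) (w : W), α ((a * b) ⊗ₜ[ℂ] w) = α (a ⊗ₜ[ℂ] α (b ⊗ₜ[ℂ] w)))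
    (w : W) (b : A) (y : A ⊗[ℂ] V) :
    actOn α w (mulRight (y ⊗ₜ[ℂ] b)) = actOn α (α (b ⊗ₜ[ℂ] w)) y := by
  induction y using TensorProduct.induction_on with
  | zero => simp
  | add x y hx hy => simp only [TensorProduct.add_tmul, map_add, hx, hy]
  | tmul a v => simp [hmul]

theorem braidPsi_actTensor {αV : A ⊗[ℂ] V →ₗ[ℂ] V} {αW : A ⊗[ℂ] W →ₗ[ℂ] W}
    (hmul : ∀ (a b : A) (w : W), αW ((a * b) ⊗ₜ[ℂ] w) = αW (a ⊗ₜ[ℂ] αW (b ⊗ₜ[ℂ] w)))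
    (γ : V →ₗ[ℂ] A ⊗[ℂ] V) (a : A) (v : V) (w : W) :
    braidPsi αW γ (actTensor αV αW (a ⊗ₜ[ℂ] (v ⊗ₜ[ℂ] w))) =
      actOn αW w (compatRight αV γ v (Coalgebra.comul (R := ℂ) a)) := by
  simp only [actTensor, LinearMap.comp_apply, TensorProduct.map_tmul, LinearMap.id_apply]
  induction Coalgebra.comul (R := ℂ) a using TensorProduct.induction_on with
  | zero => simp
  | add x y hx hy => simp only [TensorProduct.add_tmul, map_add, hx, hy]
  | tmul b c => simp [actOn_mulRight hmul]

theorem actTensor_braidPsi {αW : A ⊗[ℂ] W →ₗ[ℂ] W}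
    (hmul : ∀ (a b : A) (w : W), αW ((a * b) ⊗ₜ[ℂ] w) = αW (a ⊗ₜ[ℂ] αW (b ⊗ₜ[ℂ] w)))
    (αV : A ⊗[ℂ] V →ₗ[ℂ] V) (γ : V →ₗ[ℂ] A ⊗[ℂ] V) (a : A) (v : V) (w : W) :
    actTensor αW αV (a ⊗ₜ[ℂ] braidPsi αW γ (v ⊗ₜ[ℂ] w)) =
      actOn αW w (compatLeft αV γ v (Coalgebra.comul (R := ℂ) a)) := by
  simp only [actTensor, compatLeft, braidPsi_tmul, LinearMap.comp_apply, TensorProduct.map_tmul,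
    LinearMap.id_apply, LinearMap.flip_apply, TensorProduct.mk_apply]
  induction Coalgebra.comul (R := ℂ) a using TensorProduct.induction_on with
  | zero => simp
  | add x y hx hy => simp only [TensorProduct.add_tmul, map_add, hx, hy]
  | tmul b c =>
    induction γ v using TensorProduct.induction_on with
    | zero => simp
    | add x y hx hy => simp only [TensorProduct.tmul_add, map_add, hx, hy]
    | tmul d u => simp [hmul]

/-- The map `a ⊗ (b ⊗ v) ↦ f (a ⊗ b) ⊗ v`, with the result reassociated to the right. -/
noncomputable def extendRight (f : A ⊗[ℂ] A →ₗ[ℂ] A ⊗[ℂ] W) :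
    A ⊗[ℂ] (A ⊗[ℂ] V) →ₗ[ℂ] A ⊗[ℂ] (W ⊗[ℂ] V) :=
  (TensorProduct.assoc ℂ A W V).toLinearMap ∘ₗ TensorProduct.map f LinearMap.id
    ∘ₗ (TensorProduct.assoc ℂ A A V).symm.toLinearMap

@[simp]
theorem extendRight_tmul (f : A ⊗[ℂ] A →ₗ[ℂ] A ⊗[ℂ] W) (a b : A) (v : V) :
    extendRight f (a ⊗ₜ[ℂ] (b ⊗ₜ[ℂ] v)) =
      TensorProduct.assoc ℂ A W V (f (a ⊗ₜ[ℂ] b) ⊗ₜ[ℂ] v) := by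
  simp [extendRight]

theorem extendRight_coaction_congr {γ : V →ₗ[ℂ] A ⊗[ℂ] V}
    (hcoassoc : ∀ v : V,
      TensorProduct.map LinearMap.id γ (γ v)
        = TensorProduct.assoc ℂ A A V
            (TensorProduct.map (Coalgebra.comul (R := ℂ)) LinearMap.id (γ v)))
    {f g : A ⊗[ℂ] A →ₗ[ℂ] A ⊗[ℂ] W}
    (h : f ∘ₗ Coalgebra.comul (R := ℂ) = g ∘ₗ Coalgebra.comul (R := ℂ)) (v : V) :
    extendRight f (TensorProduct.map LinearMap.id γ (γ v)) =
      extendRight g (TensorProduct.map LinearMap.id γ (γ v)) := by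
  rw [hcoassoc]
  induction γ v using TensorProduct.induction_on with
  | zero => simp
  | add x y hx hy => simp only [map_add, hx, hy]
  | tmul a u =>
    have ha : f (Coalgebra.comul a) = g (Coalgebra.comul a) := LinearMap.congr_fun h a
    simp [extendRight, ha]

theorem coactTensor_braidPsi (α : A ⊗[ℂ] W →ₗ[ℂ] W) (γV : V →ₗ[ℂ] A ⊗[ℂ] V)
    (γW : W →ₗ[ℂ] A ⊗[ℂ] W) (v : V) (w : W) :
    coactTensor γW γV (braidPsi α γV (v ⊗ₜ[ℂ] w)) =
      extendRight (compatRight α γW w) (TensorProduct.map LinearMap.id γV (γV v)) := by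
  rw [braidPsi_tmul]
  induction γV v using TensorProduct.induction_on with
  | zero => simp
  | add x y hx hy => simp only [map_add, hx, hy]
  | tmul b u =>
    simp only [coactTensor, actOn_tmul, LinearMap.comp_apply, TensorProduct.map_tmul,
      LinearMap.id_apply]
    induction γV u using TensorProduct.induction_on with
    | zero => simp
    | add x y hx hy => simp only [TensorProduct.tmul_add, map_add, hx, hy]
    | tmul c t =>
      rw [extendRight_tmul, compatRight_tmul]
      induction γW (α (b ⊗ₜ[ℂ] w)) using TensorProduct.induction_on with
      | zero => simp
      | add x y hx hy => simp only [TensorProduct.add_tmul, map_add, hx, hy]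
      | tmul d s => simp

theorem map_braidPsi_coactTensor (α : A ⊗[ℂ] W →ₗ[ℂ] W) (γV : V →ₗ[ℂ] A ⊗[ℂ] V)
    (γW : W →ₗ[ℂ] A ⊗[ℂ] W) (v : V) (w : W) :
    TensorProduct.map LinearMap.id (braidPsi α γV) (coactTensor γV γW (v ⊗ₜ[ℂ] w)) =
      extendRight (compatLeft α γW w) (TensorProduct.map LinearMap.id γV (γV v)) := by
  simp only [coactTensor, compatLeft, LinearMap.comp_apply, TensorProduct.map_tmul]
  induction γV v using TensorProduct.induction_on with
  | zero => simp
  | add x y hx hy => simp only [TensorProduct.add_tmul, map_add, hx, hy]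
  | tmul b u =>
    induction γW w using TensorProduct.induction_on with
    | zero => simp [extendRight]
    | add x y hx hy =>
      simp only [extendRight, LinearMap.comp_add, TensorProduct.map_add_left, LinearMap.add_comp,
        TensorProduct.tmul_add, map_add, LinearMap.add_apply] at hx hy ⊢
      rw [hx, hy]
    | tmul d s =>
      simp only [LinearEquiv.coe_coe, TensorProduct.tensorTensorTensorComm_tmul,
        TensorProduct.map_tmul, braidPsi_tmul, LinearMap.mul'_apply, LinearMap.id_apply]
      induction γV u using TensorProduct.induction_on with
      | zero => simp
      | add x y hx hy => simp only [TensorProduct.tmul_add, map_add, hx, hy]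
      | tmul c t => simp

end Braiding

/-- If `V` and `W` carry compatible actions and coactions of a bialgebra `A`, then
`Ψ = (α_W ⊗ id) ∘ (id ⊗ τ) ∘ (γ_V ⊗ id) : V ⊗ W → W ⊗ V` is a module map and a
comodule map for the tensor product action and coaction. -/
theorem braiding_is_module_and_comodule_map
    {A V W : Type*} [Ring A] [Bialgebra ℂ A]
    [AddCommGroup V] [Module ℂ V] [AddCommGroup W] [Module ℂ W]
    (αV : A ⊗[ℂ] V →ₗ[ℂ] V)
    (hαV1 : ∀ v : V, αV ((1 : A) ⊗ₜ[ℂ] v) = v)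
    (hαVmul : ∀ (a b : A) (v : V), αV ((a * b) ⊗ₜ[ℂ] v) = αV (a ⊗ₜ[ℂ] αV (b ⊗ₜ[ℂ] v)))
    (γV : V →ₗ[ℂ] A ⊗[ℂ] V)
    (hγVcounit : ∀ v : V,
      (TensorProduct.lid ℂ V)
        (TensorProduct.map (Coalgebra.counit (R := ℂ)) LinearMap.id (γV v)) = v)
    (hγVcoassoc : ∀ v : V,
      TensorProduct.map LinearMap.id γV (γV v)
        = TensorProduct.assoc ℂ A A V
            (TensorProduct.map (Coalgebra.comul (R := ℂ)) LinearMap.id (γV v)))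
    (hcompatV : compatLHS αV γV = compatRHS αV γV)
    (αW : A ⊗[ℂ] W →ₗ[ℂ] W)
    (hαW1 : ∀ w : W, αW ((1 : A) ⊗ₜ[ℂ] w) = w)
    (hαWmul : ∀ (a b : A) (w : W), αW ((a * b) ⊗ₜ[ℂ] w) = αW (a ⊗ₜ[ℂ] αW (b ⊗ₜ[ℂ] w)))
    (γW : W →ₗ[ℂ] A ⊗[ℂ] W)
    (hγWcounit : ∀ w : W,
      (TensorProduct.lid ℂ W)
        (TensorProduct.map (Coalgebra.counit (R := ℂ)) LinearMap.id (γW w)) = w)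
    (hγWcoassoc : ∀ w : W,
      TensorProduct.map LinearMap.id γW (γW w)
        = TensorProduct.assoc ℂ A A W
            (TensorProduct.map (Coalgebra.comul (R := ℂ)) LinearMap.id (γW w)))
    (hcompatW : compatLHS αW γW = compatRHS αW γW) :
    braidPsi αW γV ∘ₗ actTensor αV αW
        = actTensor αW αV ∘ₗ TensorProduct.map LinearMap.id (braidPsi αW γV) ∧
    coactTensor γW γV ∘ₗ braidPsi αW γV
        = TensorProduct.map LinearMap.id (braidPsi αW γV) ∘ₗ coactTensor γV γW := by
  constructor
  · ext a v w
    simpa [← actTensor_braidPsi hαWmul, ← braidPsi_actTensor hαWmul] using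
      congrArg (actOn αW w) (LinearMap.congr_fun (compatLeft_comp_comul hcompatV v) a).symm
  · ext v w
    simpa [← coactTensor_braidPsi, ← map_braidPsi_coactTensor] using
      extendRight_coaction_congr hγVcoassoc (compatLeft_comp_comul hcompatW w).symm v
end

section
/- Let A be a cocommutative Hopf algebra over ℂ (τ ∘ Δ = Δ) with antipode S, V a complex vector space, α: A ⊗ V → V a left action and γ: V → A ⊗ V a left coaction of A on V satisfying the compatibility condition γ ∘ α = (ad ⊗ α) ∘ (id ⊗ τ ⊗ id) ∘ (Δ ⊗ γ), where ad = m ∘ (m ⊗ id) ∘ (id ⊗ τ) ∘ (id ⊗ S ⊗ id) ∘ (Δ ⊗ id): A ⊗ A → A is the adjoint action, ad(a ⊗ b) = a₍₁₎ b S(a₍₂₎). Then α and γ also satisfy the compatibility condition (m ⊗ α) ∘ (id ⊗ τ ⊗ id) ∘ (Δ ⊗ γ) = (m ⊗ id) ∘ (id ⊗ τ) ∘ (γ ⊗ id) ∘ (α ⊗ id) ∘ (id ⊗ τ) ∘ (Δ ⊗ id) as maps A ⊗ V → A ⊗ V. -/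
open scoped TensorProduct

/-- The adjoint action `ad : A ⊗ A → A`, `ad(a ⊗ b) = a₍₁₎ b S(a₍₂₎)`, of a Hopf
algebra on itself, written as
`m ∘ (m ⊗ id) ∘ (id ⊗ τ) ∘ (id ⊗ S ⊗ id) ∘ (Δ ⊗ id)`. -/
noncomputable def adAction (A : Type*) [Ring A] [HopfAlgebra ℂ A] :
    A ⊗[ℂ] A →ₗ[ℂ] A :=
  LinearMap.mul' ℂ A
    ∘ₗ TensorProduct.map (LinearMap.mul' ℂ A) LinearMap.id
    ∘ₗ (TensorProduct.assoc ℂ A A A).symm.toLinearMap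
    ∘ₗ TensorProduct.map LinearMap.id (TensorProduct.comm ℂ A A).toLinearMap
    ∘ₗ (TensorProduct.assoc ℂ A A A).toLinearMap
    ∘ₗ TensorProduct.map
        (TensorProduct.map LinearMap.id (HopfAlgebra.antipode (R := ℂ))) LinearMap.id
    ∘ₗ TensorProduct.map (Coalgebra.comul (R := ℂ)) LinearMap.id

namespace HopfAlgebra

open Coalgebra

variable {A : Type*} [Ring A] [HopfAlgebra ℂ A]

/-- `a₍₁₎ x S(a₍₂₎) a₍₃₎ = a x`. -/
theorem mul_adAction_comul (x a : A) :
    LinearMap.mul' ℂ A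
      (TensorProduct.map (adAction A ∘ₗ (TensorProduct.mk ℂ A A).flip x) LinearMap.id
        (comul (R := ℂ) a)) = a * x := by
  let F : A ⊗[ℂ] (A ⊗[ℂ] A) →ₗ[ℂ] A :=
    LinearMap.mul' ℂ A ∘ₗ TensorProduct.map (LinearMap.mulRight ℂ x)
      (LinearMap.mul' ℂ A ∘ₗ (antipode ℂ (A := A)).rTensor A)
  have had (z : A ⊗[ℂ] A) :
      LinearMap.mul' ℂ A
        (TensorProduct.map (adAction A ∘ₗ (TensorProduct.mk ℂ A A).flip x) LinearMap.id z) =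
      F (TensorProduct.assoc ℂ A A A ((comul (R := ℂ)).rTensor A z)) := by
    induction z with
    | zero => simp
    | add y z hy hz => simp only [map_add, hy, hz]
    | tmul b c =>
      simp only [TensorProduct.map_tmul, LinearMap.comp_apply, LinearMap.flip_apply,
        TensorProduct.mk_apply, adAction, LinearMap.rTensor_tmul, LinearMap.id_apply]
      induction comul (R := ℂ) b with
      | zero => simp
      | add y z hy hz => simp_all only [map_add, TensorProduct.add_tmul]
      | tmul p q => simp [F, mul_assoc]
  have hF (z : A ⊗[ℂ] A) :
      F ((comul (R := ℂ)).lTensor A z) =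
        LinearMap.mulRight ℂ x (TensorProduct.rid ℂ A ((counit (R := ℂ)).lTensor A z)) := by
    induction z with
    | zero => simp
    | add y z hy hz => simp only [map_add, hy, hz]
    | tmul b c =>
      simp [F, mul_antipode_rTensor_comul_apply, Algebra.algebraMap_eq_smul_one]
  rw [had, coassoc_apply, hF, lTensor_counit_comul]
  simp

end HopfAlgebra

namespace YetterDrinfeld

open Coalgebra

variable {A V : Type*} [Ring A] [HopfAlgebra ℂ A] [AddCommGroup V] [Module ℂ V]

/-- Right multiplication of `A` on the first factor of `A ⊗ V`, as the map
`(A ⊗ V) ⊗ A → A ⊗ V`. -/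
noncomputable def mulRightTensor (A V : Type*) [Ring A] [HopfAlgebra ℂ A]
    [AddCommGroup V] [Module ℂ V] : (A ⊗[ℂ] V) ⊗[ℂ] A →ₗ[ℂ] A ⊗[ℂ] V :=
  TensorProduct.map (LinearMap.mul' ℂ A) LinearMap.id
    ∘ₗ (TensorProduct.assoc ℂ A A V).symm.toLinearMap
    ∘ₗ TensorProduct.map LinearMap.id (TensorProduct.comm ℂ V A).toLinearMap
    ∘ₗ (TensorProduct.assoc ℂ A V A).toLinearMap

@[simp]
theorem mulRightTensor_tmul (x : A) (v : V) (a : A) :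
    mulRightTensor A V ((x ⊗ₜ[ℂ] v) ⊗ₜ[ℂ] a) = (x * a) ⊗ₜ[ℂ] v := by
  simp [mulRightTensor]

/-- For `f : A → A` and `g : A → V`, cocommutativity gives
`f(a₍₁₎) a₍₃₎ ⊗ g(a₍₂₎) = f(a₍₁₎) a₍₂₎ ⊗ g(a₍₃₎)`. -/
theorem mulRightTensor_map_comul
    (hcocomm : ∀ a : A, TensorProduct.comm ℂ A A (comul (R := ℂ) a) = comul (R := ℂ) a)
    (f : A →ₗ[ℂ] A) (g : A →ₗ[ℂ] V) (a : A) :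
    mulRightTensor A V
        (TensorProduct.map (TensorProduct.map f g ∘ₗ comul (R := ℂ)) LinearMap.id
          (comul (R := ℂ) a)) =
      TensorProduct.map
        (LinearMap.mul' ℂ A ∘ₗ TensorProduct.map f LinearMap.id ∘ₗ comul (R := ℂ)) g
        (comul (R := ℂ) a) := by
  let G : A ⊗[ℂ] (A ⊗[ℂ] A) →ₗ[ℂ] A ⊗[ℂ] V :=
    TensorProduct.map (LinearMap.mul' ℂ A ∘ₗ TensorProduct.map f LinearMap.id) g
      ∘ₗ (TensorProduct.assoc ℂ A A A).symm.toLinearMap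
  have hL (z : A ⊗[ℂ] A) :
      mulRightTensor A V
        (TensorProduct.map (TensorProduct.map f g ∘ₗ comul (R := ℂ)) LinearMap.id z) =
      G ((TensorProduct.comm ℂ A A).toLinearMap.lTensor A
        (TensorProduct.assoc ℂ A A A ((comul (R := ℂ)).rTensor A z))) := by
    induction z with
    | zero => simp
    | add y z hy hz => simp only [map_add, hy, hz]
    | tmul b c =>
      simp only [TensorProduct.map_tmul, LinearMap.comp_apply, LinearMap.rTensor_tmul,
        LinearMap.id_apply]
      induction comul (R := ℂ) b with
      | zero => simp
      | add y z hy hz => simp_all only [map_add, TensorProduct.add_tmul]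
      | tmul p q => simp [G]
  have hR (z : A ⊗[ℂ] A) :
      TensorProduct.map
        (LinearMap.mul' ℂ A ∘ₗ TensorProduct.map f LinearMap.id ∘ₗ comul (R := ℂ)) g z =
      G (TensorProduct.assoc ℂ A A A ((comul (R := ℂ)).rTensor A z)) := by
    induction z with
    | zero => simp
    | add y z hy hz => simp only [map_add, hy, hz]
    | tmul b c => simp [G]
  have hswap : (TensorProduct.comm ℂ A A).toLinearMap ∘ₗ comul (R := ℂ) = comul (R := ℂ) :=
    LinearMap.ext hcocomm
  rw [hL, hR, coassoc_apply, ← LinearMap.lTensor_comp_apply, hswap]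

/-- The action of `A` on `A ⊗ V` through `ad ⊗ α` along the comultiplication,
followed by right multiplication by `a₍₂₎`, is the action through `m ⊗ α`. -/
theorem mulRightTensor_adAction
    (hcocomm : ∀ a : A, TensorProduct.comm ℂ A A (comul (R := ℂ) a) = comul (R := ℂ) a)
    (α : A ⊗[ℂ] V →ₗ[ℂ] V) (t : A ⊗[ℂ] V) (a : A) :
    mulRightTensor A V
        (TensorProduct.map
          (TensorProduct.map (adAction A) α
            ∘ₗ (TensorProduct.tensorTensorTensorComm ℂ A A A V).toLinearMap
            ∘ₗ (TensorProduct.mk ℂ (A ⊗[ℂ] A) (A ⊗[ℂ] V)).flip t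
            ∘ₗ comul (R := ℂ)) LinearMap.id (comul (R := ℂ) a)) =
      TensorProduct.map (LinearMap.mul' ℂ A) α
        (TensorProduct.tensorTensorTensorComm ℂ A A A V (comul (R := ℂ) a ⊗ₜ[ℂ] t)) := by
  induction t with
  | zero => simp
  | add s t hs ht =>
    simp only [map_add, LinearMap.add_comp, LinearMap.comp_add, TensorProduct.map_add_left,
      LinearMap.add_apply, TensorProduct.tmul_add, hs, ht]
  | tmul x w =>
    have hact : TensorProduct.map (adAction A) α
          ∘ₗ (TensorProduct.tensorTensorTensorComm ℂ A A A V).toLinearMap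
          ∘ₗ (TensorProduct.mk ℂ (A ⊗[ℂ] A) (A ⊗[ℂ] V)).flip (x ⊗ₜ[ℂ] w) =
        TensorProduct.map (adAction A ∘ₗ (TensorProduct.mk ℂ A A).flip x)
          (α ∘ₗ (TensorProduct.mk ℂ A V).flip w) := by
      ext; simp
    have hmul : LinearMap.mul' ℂ A
          ∘ₗ TensorProduct.map (adAction A ∘ₗ (TensorProduct.mk ℂ A A).flip x) LinearMap.id
          ∘ₗ comul (R := ℂ) = LinearMap.mulRight ℂ x :=
      LinearMap.ext (HopfAlgebra.mul_adAction_comul x)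
    have h := mulRightTensor_map_comul hcocomm
      (adAction A ∘ₗ (TensorProduct.mk ℂ A A).flip x) (α ∘ₗ (TensorProduct.mk ℂ A V).flip w) a
    rw [hmul, ← hact] at h
    simp only [LinearMap.comp_assoc] at h
    rw [h]
    induction comul (R := ℂ) a with
    | zero => simp
    | add y z hy hz => simp only [map_add, TensorProduct.add_tmul, hy, hz]
    | tmul p q => simp

end YetterDrinfeld

/-- If `A` is a cocommutative Hopf algebra over `ℂ` and an action `α` and coaction `γ`
of `A` on `V` satisfy the compatibility condition
`γ ∘ α = (ad ⊗ α) ∘ (id ⊗ τ ⊗ id) ∘ (Δ ⊗ γ)`, then they also satisfy the compatibility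
condition `(m ⊗ α) ∘ (id ⊗ τ ⊗ id) ∘ (Δ ⊗ γ)
= (m ⊗ id) ∘ (id ⊗ τ) ∘ (γ ⊗ id) ∘ (α ⊗ id) ∘ (id ⊗ τ) ∘ (Δ ⊗ id)`. -/
theorem cocommutative_compatibility
    {A V : Type*} [Ring A] [HopfAlgebra ℂ A]
    (hcocomm : ∀ a : A,
      (TensorProduct.comm ℂ A A) (Coalgebra.comul (R := ℂ) a) = Coalgebra.comul (R := ℂ) a)
    [AddCommGroup V] [Module ℂ V]
    (α : A ⊗[ℂ] V →ₗ[ℂ] V)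
    (hα1 : ∀ v : V, α ((1 : A) ⊗ₜ[ℂ] v) = v)
    (hαmul : ∀ (a b : A) (v : V), α ((a * b) ⊗ₜ[ℂ] v) = α (a ⊗ₜ[ℂ] α (b ⊗ₜ[ℂ] v)))
    (γ : V →ₗ[ℂ] A ⊗[ℂ] V)
    (hγcounit : ∀ v : V,
      (TensorProduct.lid ℂ V)
        (TensorProduct.map (Coalgebra.counit (R := ℂ)) LinearMap.id (γ v)) = v)
    (hγcoassoc : ∀ v : V,
      TensorProduct.map LinearMap.id γ (γ v)
        = TensorProduct.assoc ℂ A A V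
            (TensorProduct.map (Coalgebra.comul (R := ℂ)) LinearMap.id (γ v)))
    (hcompat : γ ∘ₗ α
        = TensorProduct.map (adAction A) α
            ∘ₗ (TensorProduct.tensorTensorTensorComm ℂ A A A V).toLinearMap
            ∘ₗ TensorProduct.map (Coalgebra.comul (R := ℂ)) γ) :
    compatLHS α γ = compatRHS α γ := by
  refine TensorProduct.ext' fun a v => ?_
  have hγα : γ ∘ₗ α ∘ₗ (TensorProduct.mk ℂ A V).flip v =
      TensorProduct.map (adAction A) α
        ∘ₗ (TensorProduct.tensorTensorTensorComm ℂ A A A V).toLinearMap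
        ∘ₗ (TensorProduct.mk ℂ (A ⊗[ℂ] A) (A ⊗[ℂ] V)).flip (γ v)
        ∘ₗ Coalgebra.comul (R := ℂ) := by
    ext b
    simpa using LinearMap.congr_fun hcompat (b ⊗ₜ[ℂ] v)
  have hrhs : compatRHS α γ (a ⊗ₜ[ℂ] v) =
      YetterDrinfeld.mulRightTensor A V
        (TensorProduct.map (γ ∘ₗ α ∘ₗ (TensorProduct.mk ℂ A V).flip v) LinearMap.id
          (Coalgebra.comul (R := ℂ) a)) := by
    simp only [compatRHS, YetterDrinfeld.mulRightTensor, LinearMap.comp_apply,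
      TensorProduct.map_tmul]
    induction Coalgebra.comul (R := ℂ) a with
    | zero => simp
    | add y z hy hz => simp_all only [map_add, TensorProduct.add_tmul]
    | tmul p q => simp
  rw [hrhs, hγα, YetterDrinfeld.mulRightTensor_adAction hcocomm]
  simp [compatLHS]
end
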